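/- Given a finite set 𝒵, there exists a mapping f : 𝒳×𝒴 → 𝒵 such that, with Z = f(X,Y), min over guessing functions G(·|Y,Z) of E[G(X|Y,Z)^ρ] < 1 + 2^{ρ(H_{1/(1+ρ)}(X|Y) − log|𝒵| + 1)}. Conversely, for every random variable Z taking values in 𝒵 (drawn according to an arbitrary conditional PMF given (X,Y)), min over guessing functions G(·|Y,Z) of E[G(X|Y,Z)^ρ] ≥ max( (1 + ln|𝒳|)^{−ρ} · 2^{ρ(H_{1/(1+ρ)}(X|Y) − log|𝒵|)}, 1 ). -/

import Mathlib

open scoped BigOperators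

noncomputable section

/-- `G` is a guessing function for `X` given side information in `V`:
for every `v`, `G v` is a bijection from `X` onto `{1, …, |X|}`. -/
def IsGuess {X V : Type*} [Fintype X] (G : V → X → ℕ) : Prop :=
  ∀ v : V, Set.BijOn (G v) Set.univ (Set.Icc 1 (Fintype.card X))

/-- The conditional Rényi entropy `H_α(X|Y)` (base 2) of order `α = 1/(1+ρ)`. -/
def condRenyi {X Y : Type*} [Fintype X] [Fintype Y] (ρ : ℝ) (p : X → Y → ℝ) : ℝ :=
  ((1 / (1 + ρ)) / (1 - 1 / (1 + ρ))) *
    Real.logb 2 (∑ y : Y, (∑ x : X, p x y ^ (1 / (1 + ρ))) ^ (1 / (1 / (1 + ρ))))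

/-- An enumeration of a finite type along which a given real function is nonincreasing. -/
lemma exists_equiv_fin_antitone {X : Type*} [Fintype X] (q : X → ℝ) :
    ∃ r : X ≃ Fin (Fintype.card X), ∀ x x', r x' ≤ r x → q x ≤ q x' := by
  let e := Fintype.equivFin X
  let f : Fin (Fintype.card X) → ℝ := fun i => -q (e.symm i)
  refine ⟨e.trans (Tuple.sort f).symm, fun x x' h => ?_⟩
  simpa [f] using Tuple.monotone_sort f h

/-- The ranks of an injective key form a guessing order. -/
lemma bijOn_card_filter_le {X : Type*} [Fintype X] (k : X → ℕ) (hk : Function.Injective k) :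
    Set.BijOn (fun x => (Finset.univ.filter fun x' => k x' ≤ k x).card) Set.univ
      (Set.Icc 1 (Fintype.card X)) := by
  have hmaps : Set.MapsTo (fun x => (Finset.univ.filter fun x' => k x' ≤ k x).card)
      (↑(Finset.univ : Finset X)) (↑(Finset.Icc 1 (Fintype.card X))) := by
    intro x _
    simp only [Finset.coe_Icc, Set.mem_Icc]
    exact ⟨Finset.card_pos.mpr ⟨x, by simp⟩, Finset.card_le_univ _⟩
  have hlt : ∀ x y, k x < k y → (Finset.univ.filter fun x' => k x' ≤ k x).card <
      (Finset.univ.filter fun x' => k x' ≤ k y).card := by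
    intro x y h
    refine Finset.card_lt_card ((Finset.ssubset_iff_of_subset ?_).mpr ⟨y, by simp, by simpa using h⟩)
    exact Finset.monotone_filter_right _ fun a _ ha => ha.trans h.le
  have hinj : Set.InjOn (fun x => (Finset.univ.filter fun x' => k x' ≤ k x).card)
      (↑(Finset.univ : Finset X)) := by
    intro x _ y _ h
    by_contra hne
    rcases lt_or_gt_of_ne (hk.ne hne) with h' | h'
    · exact (hlt _ _ h').ne h
    · exact (hlt _ _ h').ne' h
  have hsurj := Finset.surjOn_of_injOn_of_card_le _ hmaps hinj (by simp)
  simp only [Finset.coe_univ, Finset.coe_Icc] at hmaps hinj hsurj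
  exact ⟨hmaps, hinj, hsurj⟩

/-- There is a guessing order that first goes through the elements whose index is congruent to `c`
modulo `m`, in increasing order of their index. -/
lemma exists_bijOn_le_div {X : Type*} [Fintype X] (r : X ≃ Fin (Fintype.card X)) (m c : ℕ) :
    ∃ g : X → ℕ, Set.BijOn g Set.univ (Set.Icc 1 (Fintype.card X)) ∧
      ∀ x, (r x : ℕ) % m = c → g x ≤ (r x : ℕ) / m + 1 := by
  let k : X → ℕ := fun x => if (r x : ℕ) % m = c then r x else Fintype.card X + r x
  have hk : Function.Injective k := by
    intro x y h
    apply r.injective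
    apply Fin.ext
    have hx := (r x).isLt
    have hy := (r y).isLt
    simp only [k] at h
    split_ifs at h <;> omega
  refine ⟨_, bijOn_card_filter_le k hk, fun x hx => ?_⟩
  have hmod : ∀ x', k x' ≤ k x → (r x' : ℕ) % m = c ∧ (r x' : ℕ) ≤ r x := by
    intro x' h
    have hx1 := (r x).isLt
    simp only [k, hx, if_true] at h
    split_ifs at h with h1
    · exact ⟨h1, h⟩
    · omega
  rw [← Finset.card_range ((r x : ℕ) / m + 1)]
  refine Finset.card_le_card_of_injOn (fun x' => (r x' : ℕ) / m) ?_ ?_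
  · intro x' h
    have h := hmod x' (by simpa using h)
    simpa [Nat.lt_succ_iff] using Nat.div_le_div_right (c := m) h.2
  · intro a ha b hb hab
    have ha := hmod a (by simpa using ha)
    have hb := hmod b (by simpa using hb)
    apply r.injective
    apply Fin.ext
    rw [← Nat.div_add_mod (r a : ℕ) m, ← Nat.div_add_mod (r b : ℕ) m, ha.1, hb.1]
    simpa using congrArg (fun t => m * t + c) hab

lemma exists_isGuess {X V : Type*} [Fintype X] : ∃ G : V → X → ℕ, IsGuess G :=
  ⟨fun _ => _, fun _ => bijOn_card_filter_le (fun x => (Fintype.equivFin X x : ℕ))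
    (Fin.val_injective.comp (Fintype.equivFin X).injective)⟩

/-- Rounding up `(a + 1) / m` costs at most a factor two and an additive one. -/
lemma natDiv_add_one_rpow_lt {ρ : ℝ} (hρ : 0 < ρ) (a : ℕ) {m : ℕ} (hm : 0 < m) :
    ((a / m + 1 : ℕ) : ℝ) ^ ρ < 1 + (2 / m : ℝ) ^ ρ * ((a : ℝ) + 1) ^ ρ := by
  have hm' : (0 : ℝ) < m := by exact_mod_cast hm
  have hpos : (0 : ℝ) < (2 / m : ℝ) ^ ρ * ((a : ℝ) + 1) ^ ρ := by positivity
  rcases Nat.eq_zero_or_pos (a / m) with h | h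
  · simp [h, hpos]
  · have hle : (((a / m + 1 : ℕ) : ℝ)) ≤ 2 / m * ((a : ℝ) + 1) := by
      have h1 : (a / m + 1) * m ≤ 2 * (a + 1) := by
        have h2 := Nat.div_mul_le_self a m
        have h3 : m ≤ a := (Nat.div_pos_iff.mp h).2
        rw [add_mul]; omega
      have h4 : (((a / m + 1 : ℕ) : ℝ)) * m ≤ 2 * (a + 1) := by exact_mod_cast h1
      rw [div_mul_eq_mul_div, le_div_iff₀ hm']
      exact h4
    have := Real.rpow_le_rpow (by positivity) hle hρ.le
    rw [Real.mul_rpow (by positivity) (by positivity)] at this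
    linarith

/-- Arıkan's upper bound for guessing in decreasing order of probability. -/
lemma sum_mul_rank_rpow_le {X : Type*} [Fintype X] {ρ : ℝ} (hρ : 0 < ρ) (q : X → ℝ)
    (hq : ∀ x, 0 ≤ q x) (r : X ≃ Fin (Fintype.card X))
    (hr : ∀ x x', r x' ≤ r x → q x ≤ q x') :
    ∑ x, q x * (((r x : ℕ) : ℝ) + 1) ^ ρ ≤ (∑ x, q x ^ (1 / (1 + ρ))) ^ (1 + ρ) := by
  set α : ℝ := 1 / (1 + ρ) with hα
  have hα0 : 0 < α := by positivity
  have hαρ : α + α * ρ = 1 := by rw [hα]; field_simp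
  set S := ∑ x, q x ^ α with hS
  have hS0 : 0 ≤ S := Finset.sum_nonneg fun x _ => Real.rpow_nonneg (hq x) _
  have hcount : ∀ x, (((r x : ℕ) : ℝ) + 1) * q x ^ α ≤ S := by
    intro x
    have hcard : (Finset.univ.filter fun x' => r x' ≤ r x).card = (r x : ℕ) + 1 := by
      rw [← Fin.card_Iic, ← Finset.card_map r.toEmbedding]
      congr 1
      ext i
      simp
    calc (((r x : ℕ) : ℝ) + 1) * q x ^ α
        = ∑ x' ∈ Finset.univ.filter (fun x' => r x' ≤ r x), q x ^ α := by
          rw [Finset.sum_const, hcard, nsmul_eq_mul]; push_cast; rfl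
      _ ≤ ∑ x' ∈ Finset.univ.filter (fun x' => r x' ≤ r x), q x' ^ α := by
          refine Finset.sum_le_sum fun x' h => ?_
          exact Real.rpow_le_rpow (hq x) (hr x x' (by simpa using h)) hα0.le
      _ ≤ S := Finset.sum_le_sum_of_subset_of_nonneg (Finset.filter_subset _ _)
          fun x' _ _ => Real.rpow_nonneg (hq x') _
  calc ∑ x, q x * (((r x : ℕ) : ℝ) + 1) ^ ρ
      ≤ ∑ x, q x ^ α * S ^ ρ := by
        refine Finset.sum_le_sum fun x _ => ?_
        have hsplit : q x = q x ^ α * (q x ^ α) ^ ρ := by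
          rw [← Real.rpow_mul (hq x), ← Real.rpow_add_of_nonneg (hq x) hα0.le (by positivity), hαρ,
            Real.rpow_one]
        have h0 := Real.rpow_nonneg (hq x) α
        calc q x * (((r x : ℕ) : ℝ) + 1) ^ ρ
            = q x ^ α * ((((r x : ℕ) : ℝ) + 1) * q x ^ α) ^ ρ := by
              rw [Real.mul_rpow (by positivity) h0]
              nth_rewrite 1 [hsplit]
              ring
          _ ≤ q x ^ α * S ^ ρ := by
              gcongr
              exact hcount x
    _ = S ^ (1 + ρ) := by
        rw [← Finset.sum_mul, Real.rpow_add_of_nonneg hS0 zero_le_one hρ.le, Real.rpow_one]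

lemma sum_inv_le_one_add_log {X : Type*} [Fintype X] {g : X → ℕ}
    (hg : Set.BijOn g Set.univ (Set.Icc 1 (Fintype.card X))) :
    ∑ x, ((g x : ℝ))⁻¹ ≤ 1 + Real.log (Fintype.card X) := by
  have h : ∑ x, ((g x : ℝ))⁻¹ = (harmonic (Fintype.card X) : ℝ) := by
    rw [harmonic_eq_sum_Icc]
    push_cast
    refine Finset.sum_nbij g ?_ ?_ ?_ fun _ _ => rfl
    · intro x _
      simpa using hg.mapsTo (Set.mem_univ x)
    · simpa using hg.injOn
    · simpa using hg.surjOn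
  rw [h]
  exact harmonic_le_one_add_log _

/-- The Hölder step of Arıkan's lower bound. -/
lemma sum_rpow_rpow_le {ι : Type*} [Fintype ι] {ρ : ℝ} (hρ : 0 < ρ) (q : ι → ℝ)
    (hq : ∀ i, 0 ≤ q i) (g : ι → ℝ) (hg : ∀ i, 0 < g i) :
    (∑ i, q i ^ (1 / (1 + ρ))) ^ (1 + ρ) ≤ (∑ i, (g i)⁻¹) ^ ρ * ∑ i, q i * g i ^ ρ := by
  have hp : (0 : ℝ) < 1 + ρ := by positivity
  have hW : 0 ≤ ∑ i, (g i)⁻¹ := Finset.sum_nonneg fun i _ => (inv_pos.mpr (hg i)).le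
  have hE : 0 ≤ ∑ i, q i * g i ^ ρ :=
    Finset.sum_nonneg fun i _ => mul_nonneg (hq i) (Real.rpow_nonneg (hg i).le _)
  have H := Real.inner_le_weight_mul_Lp_of_nonneg Finset.univ (p := 1 + ρ) (by linarith)
    (fun i => (g i)⁻¹) (fun i => q i ^ (1 / (1 + ρ)) * g i) (fun i => (inv_pos.mpr (hg i)).le)
    (fun i => mul_nonneg (Real.rpow_nonneg (hq i) _) (hg i).le)
  have h1 : ∀ i, (g i)⁻¹ * (q i ^ (1 / (1 + ρ)) * g i) = q i ^ (1 / (1 + ρ)) := by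
    intro i
    have := (hg i).ne'
    field_simp
  have h2 : ∀ i, (g i)⁻¹ * (q i ^ (1 / (1 + ρ)) * g i) ^ (1 + ρ) = q i * g i ^ ρ := by
    intro i
    have := (hg i).ne'
    rw [Real.mul_rpow (Real.rpow_nonneg (hq i) _) (hg i).le, ← Real.rpow_mul (hq i),
      one_div_mul_cancel hp.ne', Real.rpow_one, Real.rpow_add (hg i), Real.rpow_one]
    field_simp
  simp only [h1, h2] at H
  have hL : 0 ≤ ∑ i, q i ^ (1 / (1 + ρ)) := Finset.sum_nonneg fun i _ => Real.rpow_nonneg (hq i) _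
  refine (Real.rpow_le_rpow hL H hp.le).trans_eq ?_
  rw [Real.mul_rpow (Real.rpow_nonneg hW _) (Real.rpow_nonneg hE _), ← Real.rpow_mul hW,
    ← Real.rpow_mul hE, inv_mul_cancel₀ hp.ne', Real.rpow_one]
  congr 2
  field_simp
  ring

lemma sum_rpow_pos {X Y : Type*} [Fintype X] [Fintype Y] (ρ : ℝ) (p : X → Y → ℝ)
    (hp0 : ∀ x y, 0 ≤ p x y) (hp1 : ∑ x, ∑ y, p x y = 1) :
    0 < ∑ y, (∑ x, p x y ^ (1 / (1 + ρ))) ^ (1 + ρ) := by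
  obtain ⟨x, -, hx⟩ := Finset.exists_ne_zero_of_sum_ne_zero (hp1.trans_ne one_ne_zero)
  obtain ⟨y, -, hxy⟩ := Finset.exists_ne_zero_of_sum_ne_zero hx
  have hinner : ∀ y, 0 ≤ ∑ x, p x y ^ (1 / (1 + ρ)) := fun y =>
    Finset.sum_nonneg fun x _ => Real.rpow_nonneg (hp0 x y) _
  refine Finset.sum_pos' (fun y _ => Real.rpow_nonneg (hinner y) _) ⟨y, Finset.mem_univ y, ?_⟩
  refine Real.rpow_pos_of_pos ?_ _
  exact Finset.sum_pos' (fun x _ => Real.rpow_nonneg (hp0 x y) _)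
    ⟨x, Finset.mem_univ x, Real.rpow_pos_of_pos ((hp0 x y).lt_of_ne' hxy) _⟩

lemma two_rpow_mul_condRenyi_sub_logb {X Y : Type*} [Fintype X] [Fintype Y] {ρ : ℝ} (hρ : 0 < ρ)
    (p : X → Y → ℝ) (hp0 : ∀ x y, 0 ≤ p x y) (hp1 : ∑ x, ∑ y, p x y = 1) {t : ℝ} (ht : 0 < t) :
    (2 : ℝ) ^ (ρ * (condRenyi ρ p - Real.logb 2 t)) =
      (∑ y, (∑ x, p x y ^ (1 / (1 + ρ))) ^ (1 + ρ)) / t ^ ρ := by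
  have hS := sum_rpow_pos ρ p hp0 hp1
  have h1 : ρ * (1 / (1 + ρ) / (1 - 1 / (1 + ρ))) = 1 := by
    have : 1 - 1 / (1 + ρ) = ρ / (1 + ρ) := by field_simp; ring
    rw [this]
    field_simp
  rw [condRenyi, one_div_one_div, mul_sub, ← mul_assoc, h1, one_mul, Real.rpow_sub two_pos,
    Real.rpow_logb two_pos (by norm_num) hS, mul_comm ρ, Real.rpow_mul two_pos.le,
    Real.rpow_logb two_pos (by norm_num) ht]

/-- Guessing with the help of the residue of the rank of `X` modulo the number of messages. -/
lemma exists_isGuess_sum_lt {𝒳 𝒴 𝒵 : Type*} [Fintype 𝒳] [Fintype 𝒴] [Fintype 𝒵] [Nonempty 𝒵]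
    {ρ : ℝ} (hρ : 0 < ρ) (p : 𝒳 → 𝒴 → ℝ) (hp0 : ∀ x y, 0 ≤ p x y)
    (hp1 : ∑ x, ∑ y, p x y = 1) :
    ∃ f : 𝒳 × 𝒴 → 𝒵, ∃ G : 𝒴 × 𝒵 → 𝒳 → ℕ, IsGuess G ∧
      ∑ x, ∑ y, p x y * (G (y, f (x, y)) x : ℝ) ^ ρ <
        1 + (2 / Fintype.card 𝒵 : ℝ) ^ ρ * ∑ y, (∑ x, p x y ^ (1 / (1 + ρ))) ^ (1 + ρ) := by
  have hm : 0 < Fintype.card 𝒵 := Fintype.card_pos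
  choose r hr using fun y => exists_equiv_fin_antitone fun x => p x y
  let e := Fintype.equivFin 𝒵
  choose g hg hgle using fun v : 𝒴 × 𝒵 => exists_bijOn_le_div (r v.1) (Fintype.card 𝒵) (e v.2)
  let f : 𝒳 × 𝒴 → 𝒵 := fun v => e.symm ⟨(r v.2 v.1 : ℕ) % Fintype.card 𝒵, Nat.mod_lt _ hm⟩
  have hlt : ∀ x y, (g (y, f (x, y)) x : ℝ) ^ ρ <
      1 + (2 / Fintype.card 𝒵 : ℝ) ^ ρ * (((r y x : ℕ) : ℝ) + 1) ^ ρ := by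
    intro x y
    refine lt_of_le_of_lt ?_ (natDiv_add_one_rpow_lt hρ (r y x) hm)
    have h := hgle (y, f (x, y)) x (by simp [f])
    gcongr
  refine ⟨f, g, hg, ?_⟩
  obtain ⟨x₀, -, hx₀⟩ := Finset.exists_ne_zero_of_sum_ne_zero (hp1.trans_ne one_ne_zero)
  obtain ⟨y₀, -, hxy₀⟩ := Finset.exists_ne_zero_of_sum_ne_zero hx₀
  calc ∑ x, ∑ y, p x y * (g (y, f (x, y)) x : ℝ) ^ ρ
      < ∑ x, ∑ y, p x y *
          (1 + (2 / Fintype.card 𝒵 : ℝ) ^ ρ * (((r y x : ℕ) : ℝ) + 1) ^ ρ) := by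
        have hle : ∀ x y, p x y * (g (y, f (x, y)) x : ℝ) ^ ρ ≤ p x y *
            (1 + (2 / Fintype.card 𝒵 : ℝ) ^ ρ * (((r y x : ℕ) : ℝ) + 1) ^ ρ) := fun x y =>
          mul_le_mul_of_nonneg_left (hlt x y).le (hp0 x y)
        refine Finset.sum_lt_sum (fun x _ => Finset.sum_le_sum fun y _ => hle x y)
          ⟨x₀, Finset.mem_univ _, Finset.sum_lt_sum (fun y _ => hle x₀ y)
            ⟨y₀, Finset.mem_univ _, ?_⟩⟩
        exact mul_lt_mul_of_pos_left (hlt x₀ y₀) ((hp0 x₀ y₀).lt_of_ne' hxy₀)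
    _ = 1 + (2 / Fintype.card 𝒵 : ℝ) ^ ρ *
          ∑ y, ∑ x, p x y * (((r y x : ℕ) : ℝ) + 1) ^ ρ := by
        simp only [mul_add, mul_one, Finset.sum_add_distrib, hp1]
        rw [Finset.sum_comm, Finset.mul_sum]
        simp only [Finset.mul_sum, mul_left_comm]
    _ ≤ _ := by
        gcongr with y
        exact sum_mul_rank_rpow_le hρ (fun x => p x y) (fun x => hp0 x y) (r y) (hr y)

/-- Arıkan's lower bound for guessing with an additional description of `X`. -/
lemma sum_rpow_le_mul_sum_isGuess {𝒳 𝒴 𝒵 : Type*} [Fintype 𝒳] [Fintype 𝒴] [Fintype 𝒵]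
    {ρ : ℝ} (hρ : 0 < ρ) (p : 𝒳 → 𝒴 → ℝ) (hp0 : ∀ x y, 0 ≤ p x y)
    (w : 𝒳 → 𝒴 → 𝒵 → ℝ) (hw0 : ∀ x y z, 0 ≤ w x y z) (hw1 : ∀ x y, ∑ z, w x y z = 1)
    (G : 𝒴 × 𝒵 → 𝒳 → ℕ) (hG : IsGuess G) :
    ∑ y, (∑ x, p x y ^ (1 / (1 + ρ))) ^ (1 + ρ) ≤
      (Fintype.card 𝒵 * (1 + Real.log (Fintype.card 𝒳))) ^ ρ *
        ∑ x, ∑ y, ∑ z, p x y * w x y z * (G (y, z) x : ℝ) ^ ρ := by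
  have hα0 : 0 < 1 / (1 + ρ) := by positivity
  have hα1 : 1 / (1 + ρ) ≤ 1 := by rw [div_le_one (by positivity)]; linarith
  have hGpos : ∀ v x, (0 : ℝ) < G v x := fun v x => by
    exact_mod_cast (hG v).mapsTo (Set.mem_univ x) |>.1
  rw [Finset.sum_comm, Finset.mul_sum]
  refine Finset.sum_le_sum fun y _ => ?_
  have hdescr : ∀ x, p x y ^ (1 / (1 + ρ)) ≤ ∑ z, (p x y * w x y z) ^ (1 / (1 + ρ)) := by
    intro x
    calc p x y ^ (1 / (1 + ρ)) = ∑ z, p x y ^ (1 / (1 + ρ)) * w x y z := by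
          rw [← Finset.mul_sum, hw1, mul_one]
      _ ≤ _ := by
          refine Finset.sum_le_sum fun z _ => ?_
          rw [Real.mul_rpow (hp0 x y) (hw0 x y z)]
          refine mul_le_mul_of_nonneg_left ?_ (Real.rpow_nonneg (hp0 x y) _)
          refine Real.self_le_rpow_of_le_one (hw0 x y z) ?_ hα1
          rw [← hw1 x y]
          exact Finset.single_le_sum (fun z _ => hw0 x y z) (Finset.mem_univ z)
  have hHolder := sum_rpow_rpow_le hρ (fun i : 𝒳 × 𝒵 => p i.1 y * w i.1 y i.2)
    (fun i => mul_nonneg (hp0 _ _) (hw0 _ _ _)) (fun i => (G (y, i.2) i.1 : ℝ))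
    (fun i => hGpos _ _)
  have hinv : ∑ i : 𝒳 × 𝒵, ((G (y, i.2) i.1 : ℝ))⁻¹ ≤
      Fintype.card 𝒵 * (1 + Real.log (Fintype.card 𝒳)) := by
    rw [Fintype.sum_prod_type_right]
    refine (Finset.sum_le_sum fun z _ => sum_inv_le_one_add_log (hG (y, z))).trans_eq ?_
    simp [mul_add]
  calc (∑ x, p x y ^ (1 / (1 + ρ))) ^ (1 + ρ)
      ≤ (∑ i : 𝒳 × 𝒵, (p i.1 y * w i.1 y i.2) ^ (1 / (1 + ρ))) ^ (1 + ρ) := by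
        rw [Fintype.sum_prod_type]
        exact Real.rpow_le_rpow (Finset.sum_nonneg fun x _ => Real.rpow_nonneg (hp0 x y) _)
          (Finset.sum_le_sum fun x _ => hdescr x) (by positivity)
    _ ≤ _ := hHolder
    _ ≤ _ := by
        rw [← Fintype.sum_prod_type']
        refine mul_le_mul_of_nonneg_right (Real.rpow_le_rpow ?_ hinv hρ.le) ?_
        · exact Finset.sum_nonneg fun i _ => (inv_pos.mpr (hGpos _ _)).le
        · exact Finset.sum_nonneg fun i _ => mul_nonneg (mul_nonneg (hp0 _ _) (hw0 _ _ _))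
            (Real.rpow_nonneg (hGpos _ _).le _)

theorem side_information_improves_guessing_renyi
    {𝒳 𝒴 𝒵 : Type*} [Fintype 𝒳] [Fintype 𝒴] [Fintype 𝒵] [Nonempty 𝒵]
    (ρ : ℝ) (hρ : 0 < ρ)
    (p : 𝒳 → 𝒴 → ℝ) (hp0 : ∀ x y, 0 ≤ p x y) (hp1 : ∑ x : 𝒳, ∑ y : 𝒴, p x y = 1) :
    (∃ f : 𝒳 × 𝒴 → 𝒵,
      sInf {r : ℝ | ∃ G : 𝒴 × 𝒵 → 𝒳 → ℕ, IsGuess G ∧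
          r = ∑ x : 𝒳, ∑ y : 𝒴, p x y * (G (y, f (x, y)) x : ℝ) ^ ρ}
        < 1 + (2 : ℝ) ^ (ρ * (condRenyi ρ p - Real.logb 2 (Fintype.card 𝒵) + 1)))
    ∧ (∀ w : 𝒳 → 𝒴 → 𝒵 → ℝ, (∀ x y z, 0 ≤ w x y z) → (∀ x y, ∑ z : 𝒵, w x y z = 1) →
        sInf {r : ℝ | ∃ G : 𝒴 × 𝒵 → 𝒳 → ℕ, IsGuess G ∧
            r = ∑ x : 𝒳, ∑ y : 𝒴, ∑ z : 𝒵, p x y * w x y z * (G (y, z) x : ℝ) ^ ρ}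
          ≥ max ((1 + Real.log (Fintype.card 𝒳)) ^ (-ρ) *
              (2 : ℝ) ^ (ρ * (condRenyi ρ p - Real.logb 2 (Fintype.card 𝒵)))) 1) := by
  have hm : (0 : ℝ) < Fintype.card 𝒵 := by exact_mod_cast Fintype.card_pos
  refine ⟨?_, fun w hw0 hw1 => ?_⟩
  · obtain ⟨f, G, hG, hlt⟩ := exists_isGuess_sum_lt (𝒵 := 𝒵) hρ p hp0 hp1
    refine ⟨f, lt_of_le_of_lt (csInf_le ⟨0, ?_⟩ ⟨G, hG, rfl⟩) (hlt.trans_eq ?_)⟩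
    · rintro _ ⟨G, -, rfl⟩
      exact Finset.sum_nonneg fun x _ => Finset.sum_nonneg fun y _ =>
        mul_nonneg (hp0 x y) (by positivity)
    · rw [mul_add, mul_one, Real.rpow_add two_pos,
        two_rpow_mul_condRenyi_sub_logb hρ p hp0 hp1 hm, Real.div_rpow two_pos.le hm.le]
      ring
  · obtain ⟨G₀, hG₀⟩ := exists_isGuess (X := 𝒳) (V := 𝒴 × 𝒵)
    refine le_csInf ⟨_, G₀, hG₀, rfl⟩ ?_
    rintro _ ⟨G, hG, rfl⟩
    have hlog : 0 < 1 + Real.log (Fintype.card 𝒳) := by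
      have := Real.log_natCast_nonneg (Fintype.card 𝒳)
      positivity
    refine max_le ?_ ?_
    · rw [two_rpow_mul_condRenyi_sub_logb hρ p hp0 hp1 hm, Real.rpow_neg hlog.le,
        inv_mul_eq_div, div_div, div_le_iff₀ (by positivity),
        ← Real.mul_rpow hm.le hlog.le, mul_comm]
      exact sum_rpow_le_mul_sum_isGuess hρ p hp0 w hw0 hw1 G hG
    · calc (1 : ℝ) = ∑ x, ∑ y, ∑ z, p x y * w x y z := by
            simp only [← Finset.mul_sum, hw1, mul_one, hp1]
        _ ≤ _ := by
            refine Finset.sum_le_sum fun x _ => Finset.sum_le_sum fun y _ =>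
              Finset.sum_le_sum fun z _ => ?_
            refine le_mul_of_one_le_right (mul_nonneg (hp0 x y) (hw0 x y z)) ?_
            refine Real.one_le_rpow ?_ hρ.le
            exact_mod_cast ((hG (y, z)).mapsTo (Set.mem_univ x)).1
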